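/- Let d ≥ 1 and 0 < s < 1/2. There is a constant C = C(d,s) such that for every R ≥ 1 and every function u : ℝ^d → ℝ with |u| ≤ 1 on ℝ^d which is Lipschitz on B_{2R}, one has J^s(u, B_R) ≤ C · ( ∫_{B_{2R}} |∇u(x)| dx + R^{d−2s} + R^d ). -/

import Mathlib

open MeasureTheory Metric Set
open scoped ENNReal NNReal

/-- The fractional `s`-energy `J^s(u,Ω)` of `u : ℝ^d → ℝ` on an open set `Ω`:
`J^s(u,Ω) = ∬_{(ℝ^d×ℝ^d)∖(Ωᶜ×Ωᶜ)} |u(x)−u(y)|²/|x−y|^{d+2s} dy dx`, valued in `[0,∞]`. -/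
noncomputable def Js (d : ℕ) (s : ℝ) (u : EuclideanSpace ℝ (Fin d) → ℝ)
    (Ω : Set (EuclideanSpace ℝ (Fin d))) : ℝ≥0∞ :=
  ∫⁻ p : EuclideanSpace ℝ (Fin d) × EuclideanSpace ℝ (Fin d) in (Ωᶜ ×ˢ Ωᶜ)ᶜ,
    ENNReal.ofReal ((u p.1 - u p.2)^2 / ‖p.1 - p.2‖ ^ ((d : ℝ) + 2*s))

lemma aux_sym {d : ℕ} (H : EuclideanSpace ℝ (Fin d) × EuclideanSpace ℝ (Fin d) → ℝ≥0∞)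
    (hH : Measurable H) (hsym : ∀ x y, H (x, y) = H (y, x))
    (Ω : Set (EuclideanSpace ℝ (Fin d))) (hΩ : MeasurableSet Ω) :
    ∫⁻ p in (Ωᶜ ×ˢ Ωᶜ)ᶜ, H p ≤ 2 * ∫⁻ z, ∫⁻ x in Ω, H (x, x + z) := by
  have hsub : (Ωᶜ ×ˢ Ωᶜ)ᶜ ⊆ (Ω ×ˢ univ) ∪ (univ ×ˢ Ω) := by
    rintro ⟨x, y⟩ h
    simp only [mem_compl_iff, mem_prod, not_and, not_not, mem_union, mem_univ, and_true,
      true_and] at h ⊢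
    tauto
  have h1 : ∫⁻ p in Ω ×ˢ (univ : Set (EuclideanSpace ℝ (Fin d))), H p
      = ∫⁻ z, ∫⁻ x in Ω, H (x, x + z) := by
    rw [Measure.volume_eq_prod, ← Measure.prod_restrict, Measure.restrict_univ,
      lintegral_prod _ hH.aemeasurable]
    symm
    rw [lintegral_lintegral_swap]
    · apply lintegral_congr
      intro x
      exact lintegral_add_left_eq_self (fun y => H (x, y)) x
    · apply Measurable.aemeasurable
      apply hH.comp
      fun_prop
  have h2 : ∫⁻ p in (univ : Set (EuclideanSpace ℝ (Fin d))) ×ˢ Ω, H p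
      = ∫⁻ p in Ω ×ˢ (univ : Set (EuclideanSpace ℝ (Fin d))), H p := by
    rw [Measure.volume_eq_prod, ← Measure.prod_restrict, ← Measure.prod_restrict,
      Measure.restrict_univ,
      lintegral_prod_symm _ hH.aemeasurable, lintegral_prod _ hH.aemeasurable]
    simp_rw [fun x y => hsym x y]
  calc _ ≤ ∫⁻ p in (Ω ×ˢ univ) ∪ (univ ×ˢ Ω), H p := lintegral_mono_set hsub
    _ ≤ _ := lintegral_union_le _ _ _
    _ = _ := by rw [h2, h1, two_mul]

lemma aux_line {d : ℕ} {K : ℝ≥0} {v : EuclideanSpace ℝ (Fin d) → ℝ} (hv : LipschitzWith K v)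
    (z : EuclideanSpace ℝ (Fin d)) :
    ∀ᵐ x, ‖v (x + z) - v x‖ₑ ≤ ∫⁻ t in Ioc (0:ℝ) 1, ‖fderiv ℝ v (x + t • z)‖ₑ * ‖z‖ₑ := by
  have hae : ∀ᵐ x : EuclideanSpace ℝ (Fin d), ∀ᵐ t : ℝ, DifferentiableAt ℝ v (x + t • z) := by
    have hm : MeasurableSet {p : EuclideanSpace ℝ (Fin d) × ℝ |
        DifferentiableAt ℝ v (p.1 + p.2 • z)} := by
      have : Measurable (fun p : EuclideanSpace ℝ (Fin d) × ℝ => p.1 + p.2 • z) := by fun_prop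
      exact this (measurableSet_of_differentiableAt ℝ v)
    refine (Measure.ae_ae_comm hm).2 ?_
    filter_upwards with t
    have := hv.ae_differentiableAt (μ := volume)
    exact (measurePreserving_add_right volume (t • z)).quasiMeasurePreserving.ae this
  filter_upwards [hae] with x hx
  have hL : LipschitzWith (K * ‖z‖₊) (fun t : ℝ => v (x + t • z)) := by
    refine hv.comp ?_
    refine LipschitzWith.of_dist_le_mul fun a b => ?_
    simp only [dist_add_left, coe_nnnorm]
    rw [dist_eq_norm, ← sub_smul, norm_smul, dist_eq_norm, mul_comm]
  have hF := (hL.lipschitzOnWith (s := uIcc 0 1)).absolutelyContinuousOnInterval.integral_deriv_eq_sub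
  simp only [one_smul, zero_smul, add_zero] at hF
  rw [← hF, intervalIntegral.integral_of_le zero_le_one]
  refine (enorm_integral_le_lintegral_enorm _).trans ?_
  refine lintegral_mono_ae ?_
  filter_upwards [ae_restrict_of_ae hx] with t ht
  have hd : HasDerivAt (fun t : ℝ => v (x + t • z)) (fderiv ℝ v (x + t • z) z) t := by
    have h1 : HasDerivAt (fun t : ℝ => x + t • z) z t := by
      simpa using ((hasDerivAt_id t).smul_const z).const_add x
    exact ht.hasFDerivAt.comp_hasDerivAt t h1
  rw [hd.deriv]
  exact ContinuousLinearMap.le_opENorm _ _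

lemma aux_trans {d : ℕ} {K : ℝ≥0} {v : EuclideanSpace ℝ (Fin d) → ℝ} (hv : LipschitzWith K v)
    (z : EuclideanSpace ℝ (Fin d)) (hz : ‖z‖ < 1) (R : ℝ) (hR : 1 ≤ R) :
    ∫⁻ x in ball 0 R, ‖v (x + z) - v x‖ₑ ≤
      ‖z‖ₑ * ∫⁻ x in ball 0 (2 * R), ‖fderiv ℝ v x‖ₑ := by
  have hmf : Measurable (fun x => ‖fderiv ℝ v x‖ₑ) := (measurable_fderiv ℝ v).enorm
  calc _ ≤ ∫⁻ x in ball 0 R, ∫⁻ t in Ioc (0:ℝ) 1, ‖fderiv ℝ v (x + t • z)‖ₑ * ‖z‖ₑ :=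
        lintegral_mono_ae (ae_restrict_of_ae (aux_line hv z))
    _ = ∫⁻ t in Ioc (0:ℝ) 1, ∫⁻ x in ball 0 R, ‖fderiv ℝ v (x + t • z)‖ₑ * ‖z‖ₑ := by
        apply lintegral_lintegral_swap
        apply Measurable.aemeasurable
        apply Measurable.mul_const
        exact hmf.comp (g := fun x => ‖fderiv ℝ v x‖ₑ)
          (f := fun p : EuclideanSpace ℝ (Fin d) × ℝ => p.1 + p.2 • z) (by fun_prop)
    _ ≤ ∫⁻ t in Ioc (0:ℝ) 1, ‖z‖ₑ * ∫⁻ x in ball 0 (2 * R), ‖fderiv ℝ v x‖ₑ := by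
        refine setLIntegral_mono measurable_const fun t ht => ?_
        rw [lintegral_mul_const' _ _ enorm_ne_top, mul_comm]
        refine mul_le_mul_right ?_ _
        rw [← lintegral_indicator measurableSet_ball, ← lintegral_indicator measurableSet_ball,
          ← lintegral_add_right_eq_self ((ball 0 (2 * R)).indicator _) (t • z)]
        refine lintegral_mono fun x => ?_
        by_cases hx : x ∈ ball (0 : EuclideanSpace ℝ (Fin d)) R
        · have h2 : x + t • z ∈ ball (0 : EuclideanSpace ℝ (Fin d)) (2 * R) := by
            rw [mem_ball_zero_iff] at hx ⊢
            have h3 := norm_add_le x (t • z)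
            rw [norm_smul, Real.norm_eq_abs, abs_of_pos ht.1] at h3
            nlinarith [norm_nonneg z, ht.1, ht.2]
          rw [indicator_of_mem hx, indicator_of_mem h2]
        · rw [indicator_of_notMem hx]; exact zero_le
    _ = _ := by simp

lemma aux_k1 {d : ℕ} (s : ℝ) (hs0 : 0 < s) :
    ∫⁻ z : EuclideanSpace ℝ (Fin d), (ball 0 1)ᶜ.indicator
      (fun z => ENNReal.ofReal (4 / ‖z‖ ^ ((d : ℝ) + 2*s))) z < ∞ := by
  have h := finite_integral_one_add_norm (E := EuclideanSpace ℝ (Fin d)) (μ := volume)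
    (r := (d:ℝ) + 2*s) (by simp [hs0])
  have hr : 0 ≤ (d:ℝ) + 2*s := by positivity
  calc _ ≤ ∫⁻ z : EuclideanSpace ℝ (Fin d), ENNReal.ofReal (4 * 2 ^ ((d : ℝ) + 2*s)) *
        ENNReal.ofReal ((1 + ‖z‖) ^ (-((d : ℝ) + 2*s))) := by
        refine lintegral_mono fun z => ?_
        by_cases hz : z ∈ (ball (0 : EuclideanSpace ℝ (Fin d)) 1)ᶜ
        · rw [indicator_of_mem hz, ← ENNReal.ofReal_mul (by positivity)]
          apply ENNReal.ofReal_le_ofReal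
          rw [mem_compl_iff, mem_ball_zero_iff, not_lt] at hz
          have hz0 : 0 < ‖z‖ := by linarith
          rw [Real.rpow_neg (by positivity), ← div_eq_mul_inv,
            div_le_div_iff₀ (by positivity) (by positivity), mul_assoc,
            ← Real.mul_rpow (by positivity) (by positivity)]
          gcongr
          linarith
        · rw [indicator_of_notMem hz]; exact zero_le
    _ < ∞ := by
        rw [lintegral_const_mul' _ _ ENNReal.ofReal_ne_top]
        exact ENNReal.mul_lt_top ENNReal.ofReal_lt_top h

lemma aux_k2 {d : ℕ} (hd : 1 ≤ d) (s : ℝ) (hs0 : 0 < s) (hs : s < 1/2) :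
    ∫⁻ z : EuclideanSpace ℝ (Fin d), (ball 0 1).indicator
      (fun z => ENNReal.ofReal (2 / ‖z‖ ^ ((d : ℝ) + 2*s))) z * ‖z‖ₑ < ∞ := by
  have h := integrableOn_ball_of_norm_le_rpow (E := EuclideanSpace ℝ (Fin d)) (μ := volume)
    (f := fun z => 2 / ‖z‖ ^ ((d : ℝ) + 2*s) * ‖z‖) (C := 2) (α := (d:ℝ) + 2*s - 1) (r := 1)
    (by simpa using hd) (by simp; linarith) ?_ ?_
  · have h2 := h.2
    rw [HasFiniteIntegral, ← lintegral_indicator measurableSet_ball] at h2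
    refine lt_of_le_of_lt (lintegral_mono fun z => ?_) h2
    by_cases hz : z ∈ ball (0 : EuclideanSpace ℝ (Fin d)) 1
    · rw [indicator_of_mem hz, indicator_of_mem hz, enorm_mul, enorm_norm,
        Real.enorm_of_nonneg (by positivity)]
    · simp [indicator_of_notMem hz]
  · filter_upwards with z
    rw [Real.norm_of_nonneg (by positivity)]
    rcases eq_or_ne z 0 with rfl | hz
    · simp; positivity
    · have hz0 : 0 < ‖z‖ := norm_pos_iff.2 hz
      rw [neg_sub, Real.rpow_sub hz0, Real.rpow_one]
      apply le_of_eq; ring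
  · apply Measurable.aestronglyMeasurable
    fun_prop

/-- Let `d ≥ 1`, `0 < s < 1/2`. There is `C = C(d,s)` such that for every
`R ≥ 1` and every `u : ℝ^d → ℝ` with `|u| ≤ 1` on `ℝ^d`, Lipschitz on `B_{2R}`, one has
`J^s(u,B_R) ≤ C · ( ∫_{B_{2R}} |∇u| + R^{d−2s} + R^d )`. -/
theorem stmt2 (d : ℕ) (hd : 1 ≤ d) (s : ℝ) (hs0 : 0 < s) (hs : s < 1/2) :
    ∃ C : ℝ, 0 < C ∧ ∀ R : ℝ, 1 ≤ R →
      ∀ u : EuclideanSpace ℝ (Fin d) → ℝ, (∀ x, |u x| ≤ 1) →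
        (∃ K : ℝ≥0, LipschitzOnWith K u (ball (0 : EuclideanSpace ℝ (Fin d)) (2*R))) →
        Js d s u (ball (0 : EuclideanSpace ℝ (Fin d)) R) ≤
          ENNReal.ofReal (C * ((∫ x in ball (0 : EuclideanSpace ℝ (Fin d)) (2*R),
            ‖fderiv ℝ u x‖) + R ^ ((d : ℝ) - 2*s) + R ^ (d : ℝ))) := by
  have hA1 := aux_k1 (d := d) s hs0
  have hA2 := aux_k2 hd s hs0 hs
  set k1 : EuclideanSpace ℝ (Fin d) → ℝ≥0∞ := (ball 0 1)ᶜ.indicator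
      (fun z => ENNReal.ofReal (4 / ‖z‖ ^ ((d : ℝ) + 2*s))) with hk1
  set k2 : EuclideanSpace ℝ (Fin d) → ℝ≥0∞ := (ball 0 1).indicator
      (fun z => ENNReal.ofReal (2 / ‖z‖ ^ ((d : ℝ) + 2*s))) with hk2
  have mk1 : Measurable k1 := Measurable.indicator (by fun_prop) measurableSet_ball.compl
  have mk2 : Measurable k2 := Measurable.indicator (by fun_prop) measurableSet_ball
  have sk1 : ∀ z, k1 (-z) = k1 z := by
    intro z; simp [hk1, indicator]
  have sk2 : ∀ z, k2 (-z) = k2 z := by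
    intro z; simp [hk2, indicator]
  set A1 := ∫⁻ z, k1 z with hA1d
  set A2 := ∫⁻ z, k2 z * ‖z‖ₑ with hA2d
  set b := volume (ball (0 : EuclideanSpace ℝ (Fin d)) 1) with hb
  have hbt : b < ∞ := measure_ball_lt_top
  refine ⟨2 * (A1 * b).toReal + 2 * A2.toReal + 1, by positivity, ?_⟩
  rintro R hR u hu ⟨K, hK⟩
  obtain ⟨v, hv, huv⟩ := hK.extend_real
  set D := ∫⁻ x in ball 0 (2 * R), ‖fderiv ℝ v x‖ₑ with hD
  set I := ∫ x in ball (0 : EuclideanSpace ℝ (Fin d)) (2*R), ‖fderiv ℝ u x‖ with hI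
  have hI0 : 0 ≤ I := integral_nonneg fun _ => norm_nonneg _
  have hDI : D = ENNReal.ofReal I := by
    have e1 : I = ∫ x in ball (0 : EuclideanSpace ℝ (Fin d)) (2*R), ‖fderiv ℝ v x‖ := by
      refine setIntegral_congr_fun measurableSet_ball fun x hx => ?_
      have : u =ᶠ[nhds x] v := huv.eventuallyEq_of_mem (isOpen_ball.mem_nhds hx)
      simp only [this.fderiv_eq]
    have hint : IntegrableOn (fun x => fderiv ℝ v x)
        (ball (0 : EuclideanSpace ℝ (Fin d)) (2*R)) := by
      refine Measure.integrableOn_of_bounded (M := K) measure_ball_lt_top.ne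
        (measurable_fderiv ℝ v).aestronglyMeasurable ?_
      filter_upwards with x
      exact norm_fderiv_le_of_lipschitz ℝ hv
    rw [e1, ofReal_integral_norm_eq_lintegral_enorm hint]
  set H : EuclideanSpace ℝ (Fin d) × EuclideanSpace ℝ (Fin d) → ℝ≥0∞ :=
    fun p => k1 (p.2 - p.1) + k2 (p.2 - p.1) * ‖v p.2 - v p.1‖ₑ with hH
  have mv : Measurable v := hv.continuous.measurable
  have mH : Measurable H := by
    have : Measurable (fun p : EuclideanSpace ℝ (Fin d) × EuclideanSpace ℝ (Fin d) =>
      p.2 - p.1) := by fun_prop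
    exact (mk1.comp this).add ((mk2.comp this).mul (by fun_prop))
  have hsym : ∀ x y, H (x, y) = H (y, x) := by
    intro x y
    simp only [hH]
    rw [← neg_sub x y, sk1, sk2, ← neg_sub (v x) (v y), enorm_neg]
  have hmain : Js d s u (ball 0 R) ≤ 2 * ∫⁻ z, ∫⁻ x in ball 0 R, H (x, x + z) := by
    refine le_trans ?_ (aux_sym H mH hsym _ measurableSet_ball)
    unfold Js
    refine setLIntegral_mono mH ?_
    rintro ⟨x, y⟩ hp
    have hu2 : |u x - u y| ≤ 2 := by
      have := abs_sub (u x) (u y)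
      linarith [hu x, hu y]
    simp only [hH]
    rw [norm_sub_rev x y]
    by_cases hz : y - x ∈ ball (0 : EuclideanSpace ℝ (Fin d)) 1
    · have hz1 := mem_ball_zero_iff.1 hz
      have hxy : x ∈ ball (0 : EuclideanSpace ℝ (Fin d)) (2*R) ∧
          y ∈ ball (0 : EuclideanSpace ℝ (Fin d)) (2*R) := by
        simp only [mem_compl_iff, mem_prod, not_and, not_not, mem_ball_zero_iff] at hp ⊢
        have h1 := norm_sub_norm_le x y
        have h2 := norm_sub_norm_le y x
        rw [norm_sub_rev x y] at h1
        by_cases hx : ‖x‖ < R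
        · constructor <;> linarith
        · have := hp hx
          constructor <;> linarith
      refine le_trans ?_ le_add_self
      rw [hk2, indicator_of_mem hz, ← huv hxy.1, ← huv hxy.2, Real.enorm_eq_ofReal_abs,
        ← ENNReal.ofReal_mul (by positivity), div_mul_eq_mul_div, abs_sub_comm]
      apply ENNReal.ofReal_le_ofReal
      gcongr
      rw [← sq_abs, sq]
      gcongr
    · refine le_trans ?_ le_self_add
      rw [hk1, indicator_of_mem hz]
      apply ENNReal.ofReal_le_ofReal
      gcongr
      rw [← sq_abs]
      nlinarith [abs_nonneg (u x - u y)]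
  have hvol : volume (ball (0 : EuclideanSpace ℝ (Fin d)) R) = ENNReal.ofReal (R ^ (d:ℝ)) * b := by
    have : Nonempty (Fin d) := ⟨⟨0, hd⟩⟩
    rw [Measure.addHaar_ball _ _ (by linarith)]
    simp [hb]
  have hin : ∫⁻ z, ∫⁻ x in ball 0 R, H (x, x + z) ≤
      A1 * (ENNReal.ofReal (R ^ (d:ℝ)) * b) + A2 * D := by
    calc _ ≤ ∫⁻ z, (k1 z * (ENNReal.ofReal (R ^ (d:ℝ)) * b) + k2 z * ‖z‖ₑ * D) := by
          refine lintegral_mono fun z => ?_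
          simp only [hH, add_sub_cancel_left]
          rw [lintegral_add_left measurable_const, setLIntegral_const, hvol,
            lintegral_const_mul _ (by fun_prop)]
          refine add_le_add le_rfl ?_
          by_cases hz : z ∈ ball (0 : EuclideanSpace ℝ (Fin d)) 1
          · rw [mul_assoc]
            gcongr
            exact aux_trans hv z (mem_ball_zero_iff.1 hz) R hR
          · simp [hk2, indicator_of_notMem hz]
      _ = _ := by
          rw [lintegral_add_left (mk1.mul_const _), lintegral_mul_const _ mk1,
            lintegral_mul_const D (f := fun z => k2 z * ‖z‖ₑ) (mk2.mul measurable_enorm)]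
  refine hmain.trans ?_
  have hA1b : A1 * b ≠ ∞ := (ENNReal.mul_lt_top hA1 hbt).ne
  have hR0 : 0 ≤ R ^ (d:ℝ) := by positivity
  have hR1 : 0 ≤ R ^ ((d:ℝ) - 2*s) := by positivity
  calc _ ≤ 2 * (A1 * (ENNReal.ofReal (R ^ (d:ℝ)) * b) + A2 * D) := by gcongr
    _ = ENNReal.ofReal (2 * ((A1 * b).toReal * R ^ (d:ℝ) + A2.toReal * I)) := by
        rw [ENNReal.ofReal_mul (by norm_num), ENNReal.ofReal_add (by positivity) (by positivity),
          ENNReal.ofReal_mul (by positivity), ENNReal.ofReal_mul (by positivity),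
          ENNReal.ofReal_toReal hA1b, ENNReal.ofReal_toReal hA2.ne, hDI]
        simp only [ENNReal.ofReal_ofNat]
        ring
    _ ≤ _ := by
        apply ENNReal.ofReal_le_ofReal
        have h1 : 0 ≤ (A1 * b).toReal := ENNReal.toReal_nonneg
        have h2 : 0 ≤ A2.toReal := ENNReal.toReal_nonneg
        nlinarith [mul_nonneg h1 hI0, mul_nonneg h1 hR1, mul_nonneg h2 hR0, mul_nonneg h2 hR1]
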